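/- arXiv:1611.01115 — 2 statements merged into one kernel-verified Lean document; each statement's English description precedes it below -/
import Mathlib

section
/- For every n ≥ 1, b_n = Σ_{ℓ≥1} Σ Π_{i=1}^{ℓ} a_{k_i}, where the inner sum is over all compositions k_1 + … + k_ℓ = n of n into ℓ positive parts. Equivalently, every bridge decomposes uniquely as a concatenation (with normalizing symmetries applied) of irreducible bridges. -/
open Filter

/-- The oriented step relation of the Manhattan lattice. -/
def taxiStep (u v : ℤ × ℤ) : Prop :=
  (Even u.2 ∧ v = (u.1 + 1, u.2)) ∨
  (Odd u.2 ∧ v = (u.1 - 1, u.2)) ∨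
  (Even u.1 ∧ v = (u.1, u.2 + 1)) ∨
  (Odd u.1 ∧ v = (u.1, u.2 - 1))

/-- Perpendicularity of two step vectors. -/
def perp (d e : ℤ × ℤ) : Prop := d.1 * e.1 + d.2 * e.2 = 0

instance (d e : ℤ × ℤ) : Decidable (perp d e) := by unfold perp; infer_instance

/-- The walk `l` turns at its `i`-th vertex (meaningful for `1 ≤ i ≤ l.length - 2`). -/
def turnAt (l : List (ℤ × ℤ)) (i : ℕ) : Prop :=
  perp (l.getD i 0 - l.getD (i - 1) 0) (l.getD (i + 1) 0 - l.getD i 0)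

instance (l : List (ℤ × ℤ)) (i : ℕ) : Decidable (turnAt l i) := by
  unfold turnAt; infer_instance

/-- A taxi walk, recorded as its list of vertices (a walk of length `n` has `n + 1` vertices). -/
def IsTaxiWalk (l : List (ℤ × ℤ)) : Prop :=
  l ≠ [] ∧ l.Nodup ∧
  (∀ i, i + 1 < l.length → taxiStep (l.getD i 0) (l.getD (i + 1) 0)) ∧
  (∀ i, 1 ≤ i → i + 2 < l.length → ¬(turnAt l i ∧ turnAt l (i + 1)))

/-- The set of taxi walks of length `n` starting at the origin. -/
def originWalks (n : ℕ) : Set (List (ℤ × ℤ)) :=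
  {l | IsTaxiWalk l ∧ l.length = n + 1 ∧ l.getD 0 0 = 0}

/-- `taxiCount n` is `c_n`, the number of taxi walks of length `n` starting at the origin. -/
noncomputable def taxiCount (n : ℕ) : ℕ := (originWalks n).ncard

/-- The turn-word of a walk: `true` (the letter `t`) where the walk turns,
`false` (the letter `s`) where it goes straight. -/
def turnWord (l : List (ℤ × ℤ)) : List Bool :=
  (List.range (l.length - 2)).map fun i => decide (turnAt l (i + 1))

/-- The encoding of a taxi walk starting at the origin: the first coordinate is `true`
(for `N`) if `v₁ = (0,1)` and `false` (for `E`) if `v₁ = (1,0)`; the second is the turn-word. -/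
def encode (l : List (ℤ × ℤ)) : Bool × List Bool :=
  (decide (l.getD 1 0 = (0, 1)), turnWord l)

/-- A bridge: a taxi walk from `(0,0)` to `(1,0)` staying at abscissa `≥ 1` after the start,
whose last step is horizontal and ends at maximal abscissa. -/
def IsBridge (l : List (ℤ × ℤ)) : Prop :=
  IsTaxiWalk l ∧ 2 ≤ l.length ∧ l.getD 0 0 = (0, 0) ∧ l.getD 1 0 = (1, 0) ∧
  (∀ i, 1 ≤ i → i < l.length → 1 ≤ (l.getD i 0).1) ∧
  (l.getD (l.length - 1) 0).2 = (l.getD (l.length - 2) 0).2 ∧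
  (∀ i, i < l.length → (l.getD i 0).1 ≤ (l.getD (l.length - 1) 0).1)

/-- `bridgeCount n` is `b_n`, the number of bridges of length `n`, with `b_0 = 1`. -/
noncomputable def bridgeCount : ℕ → ℕ
  | 0 => 1
  | n + 1 => {l : List (ℤ × ℤ) | IsBridge l ∧ l.length = n + 2}.ncard

/-- The normalizing symmetry `f_{(x,y)}` of the oriented Manhattan lattice. -/
def normMap (p : ℤ × ℤ) (q : ℤ × ℤ) : ℤ × ℤ :=
  if Even p.1 then
    (if Even p.2 then (q.1 - p.1, q.2 - p.2) else (-(q.1 - p.1), q.2 - p.2))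
  else
    (if Even p.2 then (q.1 - p.1, -(q.2 - p.2)) else (-(q.1 - p.1), -(q.2 - p.2)))

/-- The vertex `v_i` is a cutvertex of the bridge `l`. -/
def IsCutAt (l : List (ℤ × ℤ)) (i : ℕ) : Prop :=
  0 < i ∧ i + 1 < l.length ∧
  IsBridge (l.take (i + 1)) ∧
  l.getD (i + 1) 0 = l.getD i 0 + (1, 0) ∧
  IsBridge ((l.drop i).map (normMap (l.getD i 0)))

/-- An irreducible bridge: a bridge with no cutvertex. -/
def IsIrreducibleBridge (l : List (ℤ × ℤ)) : Prop :=
  IsBridge l ∧ ∀ i, ¬ IsCutAt l i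

/-- `irrBridgeCount n` is `a_n`, the number of irreducible bridges of length `n`, with `a_0 = 0`. -/
noncomputable def irrBridgeCount : ℕ → ℕ
  | 0 => 0
  | n + 1 => {l : List (ℤ × ℤ) | IsIrreducibleBridge l ∧ l.length = n + 2}.ncard

/-- The conditions defining a bridge of length `n`, for a walk given as a sequence of vertices. -/
structure IsBridgePath (w : ℕ → ℤ × ℤ) (n : ℕ) : Prop where
  pos : 1 ≤ n
  zero : w 0 = (0, 0)
  one : w 1 = (1, 0)
  ne : ∀ i j, i < j → j ≤ n → w i ≠ w j
  step : ∀ i, i + 1 ≤ n → taxiStep (w i) (w (i + 1))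
  not_turn : ∀ i, i + 3 ≤ n →
    ¬(perp (w (i + 1) - w i) (w (i + 2) - w (i + 1)) ∧
      perp (w (i + 2) - w (i + 1)) (w (i + 3) - w (i + 2)))
  left : ∀ i, 1 ≤ i → i ≤ n → 1 ≤ (w i).1
  last : (w n).2 = (w (n - 1)).2
  right : ∀ i, i ≤ n → (w i).1 ≤ (w n).1

/-- A geometric description of the cutvertices of a bridge of length `n`. -/
structure IsCutPath (w : ℕ → ℤ × ℤ) (n k : ℕ) : Prop where
  pos : 0 < k
  lt : k < n
  last : (w k).2 = (w (k - 1)).2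
  before : ∀ i, i ≤ k → (w i).1 ≤ (w k).1
  after : ∀ i, k < i → i ≤ n → (w k).1 < (w i).1

theorem isBridge_iff_isBridgePath (l : List (ℤ × ℤ)) (n : ℕ) (hl : l.length = n + 1) :
    IsBridge l ↔ IsBridgePath (fun i => l.getD i 0) n := by
  constructor
  · rintro ⟨⟨-, hnd, hs, ht⟩, h2, h0, h1, hleft, hlast, hmax⟩
    rw [hl] at hs ht h2 hleft hlast hmax
    refine ⟨by omega, h0, h1, ?_, fun i hi => hs i (by omega), ?_, fun i h h' => hleft i h (by omega),
      hlast, fun i hi => hmax i (by omega)⟩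
    · intro i j hij hj
      simp only [List.getD_eq_getElem l 0 (show i < l.length by omega),
        List.getD_eq_getElem l 0 (show j < l.length by omega)]
      intro h
      exact hij.ne ((List.Nodup.getElem_inj_iff hnd).1 h)
    · intro i hi
      exact ht (i + 1) (by omega) (by omega)
  · intro h
    have hp := h.pos
    refine ⟨⟨?_, ?_, ?_, ?_⟩, by omega, h.zero, h.one, ?_, ?_, ?_⟩
    · rintro rfl
      simp at hl
    · rw [List.nodup_iff_pairwise_ne, List.pairwise_iff_getElem]
      intro i j hi hj hij
      have := h.ne i j hij (by omega)
      simpa only [List.getD_eq_getElem l 0 hi, List.getD_eq_getElem l 0 hj] using this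
    · exact fun i hi => h.step i (by omega)
    · intro i hi hi'
      obtain ⟨i, rfl⟩ : ∃ j, i = j + 1 := ⟨i - 1, by omega⟩
      exact h.not_turn i (by omega)
    · exact fun i h1 hi => h.left i h1 (by omega)
    · have := h.last
      rw [hl]
      exact this
    · intro i hi
      have := h.right i (by omega)
      rw [hl]
      exact this

theorem IsBridgePath.congr {w w' : ℕ → ℤ × ℤ} {n : ℕ} (h : IsBridgePath w n)
    (hw : ∀ i, i ≤ n → w i = w' i) : IsBridgePath w' n := by
  have hp := h.pos
  refine ⟨hp, ?_, ?_, ?_, ?_, ?_, ?_, ?_, ?_⟩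
  · rw [← hw 0 (by omega), h.zero]
  · rw [← hw 1 (by omega), h.one]
  · intro i j hij hj
    rw [← hw i (by omega), ← hw j hj]
    exact h.ne i j hij hj
  · intro i hi
    rw [← hw i (by omega), ← hw (i + 1) hi]
    exact h.step i hi
  · intro i hi
    rw [← hw i (by omega), ← hw (i + 1) (by omega), ← hw (i + 2) (by omega), ← hw (i + 3) hi]
    exact h.not_turn i hi
  · intro i h1 hi
    rw [← hw i hi]
    exact h.left i h1 hi
  · rw [← hw n le_rfl, ← hw (n - 1) (by omega)]
    exact h.last
  · intro i hi
    rw [← hw i hi, ← hw n le_rfl]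
    exact h.right i hi

theorem normMap_fst {p : ℤ × ℤ} (hp : Even p.2) (q : ℤ × ℤ) : (normMap p q).1 = q.1 - p.1 := by
  unfold normMap
  split_ifs <;> rfl

theorem normMap_snd {p : ℤ × ℤ} (hp : Even p.2) (q : ℤ × ℤ) :
    (normMap p q).2 = if Even p.1 then q.2 - p.2 else -(q.2 - p.2) := by
  unfold normMap
  split_ifs <;> rfl

theorem normMap_snd_eq_iff {p : ℤ × ℤ} (hp : Even p.2) (q r : ℤ × ℤ) :
    (normMap p q).2 = (normMap p r).2 ↔ q.2 = r.2 := by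
  rw [normMap_snd hp, normMap_snd hp]
  split_ifs <;> omega

theorem normMap_injective {p : ℤ × ℤ} (hp : Even p.2) : Function.Injective (normMap p) := by
  intro q r h
  have h1 := congrArg Prod.fst h
  have h2 := congrArg Prod.snd h
  rw [normMap_fst hp, normMap_fst hp] at h1
  rw [normMap_snd_eq_iff hp] at h2
  exact Prod.ext (by omega) h2

theorem normMap_self (p : ℤ × ℤ) : normMap p p = (0, 0) := by
  unfold normMap
  split_ifs <;> simp

theorem perp_normMap_iff {p : ℤ × ℤ} (hp : Even p.2) (a b c d : ℤ × ℤ) :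
    perp (normMap p a - normMap p b) (normMap p c - normMap p d) ↔ perp (a - b) (c - d) := by
  simp only [perp, Prod.fst_sub, Prod.snd_sub, normMap_fst hp, normMap_snd hp]
  split_ifs <;> ring_nf

theorem taxiStep_normMap_iff {p : ℤ × ℤ} (hp : Even p.2) (a b : ℤ × ℤ) :
    taxiStep (normMap p a) (normMap p b) ↔ taxiStep a b := by
  simp only [taxiStep, Prod.ext_iff, normMap_fst hp, normMap_snd hp]
  rcases Int.even_or_odd p.1 with h | h
  · simp only [if_pos h]
    grind
  · simp only [if_neg (Int.not_even_iff_odd.2 h)]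
    grind

/-- The inverse of `normMap p`, for `p` of even ordinate. -/
def denormMap (p q : ℤ × ℤ) : ℤ × ℤ :=
  if Even p.1 then (q.1 + p.1, q.2 + p.2) else (q.1 + p.1, p.2 - q.2)

theorem normMap_denormMap {p : ℤ × ℤ} (hp : Even p.2) (q : ℤ × ℤ) :
    normMap p (denormMap p q) = q := by
  unfold normMap denormMap
  split_ifs <;> ext <;> simp

theorem IsBridgePath.last_eq {w : ℕ → ℤ × ℤ} {n : ℕ} (h : IsBridgePath w n) :
    Even (w n).2 ∧ w n = w (n - 1) + (1, 0) := by
  have hp := h.pos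
  have h1 := h.step (n - 1) (by omega)
  rw [Nat.sub_add_cancel hp] at h1
  have h2 := h.last
  have h3 := h.right (n - 1) (by omega)
  simp only [taxiStep, Prod.ext_iff, Prod.fst_add, Prod.snd_add] at h1 ⊢
  grind

theorem IsCutPath.step_eq {w : ℕ → ℤ × ℤ} {n k : ℕ} (h : IsBridgePath w n)
    (hk : IsCutPath w n k) : w (k + 1) = w k + (1, 0) := by
  have h1 := h.step k hk.lt
  have h2 := hk.after (k + 1) (by omega) hk.lt
  simp only [taxiStep, Prod.ext_iff, Prod.fst_add, Prod.snd_add] at h1 ⊢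
  grind

theorem IsCutPath.isBridgePath_left {w : ℕ → ℤ × ℤ} {n k : ℕ} (h : IsBridgePath w n)
    (hk : IsCutPath w n k) : IsBridgePath w k := by
  have := hk.lt
  exact ⟨hk.pos, h.zero, h.one, fun i j hij hj => h.ne i j hij (by omega),
    fun i hi => h.step i (by omega), fun i hi => h.not_turn i (by omega),
    fun i h1 hi => h.left i h1 (by omega), hk.last, hk.before⟩

theorem IsCutPath.isBridgePath_right {w : ℕ → ℤ × ℤ} {n k : ℕ} (h : IsBridgePath w n)
    (hk : IsCutPath w n k) : IsBridgePath (fun i => normMap (w k) (w (k + i))) (n - k) := by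
  have hlt := hk.lt
  have hev := (hk.isBridgePath_left h).last_eq.1
  refine ⟨by omega, normMap_self _, ?_, ?_, ?_, ?_, ?_, ?_, ?_⟩
  · simp only [hk.step_eq h, Prod.ext_iff, normMap_fst hev, normMap_snd hev]
    simp
  · intro i j hij hj he
    exact h.ne (k + i) (k + j) (by omega) (by omega) (normMap_injective hev he)
  · intro i hi
    rw [taxiStep_normMap_iff hev]
    exact h.step (k + i) (by omega)
  · intro i hi
    simp only [perp_normMap_iff hev]
    exact h.not_turn (k + i) (by omega)
  · intro i h1 hi
    have := hk.after (k + i) (by omega) (by omega)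
    rw [normMap_fst hev]
    omega
  · rw [normMap_snd_eq_iff hev, Nat.add_sub_cancel' hlt.le,
      show k + (n - k - 1) = n - 1 by omega]
    exact h.last
  · intro i hi
    have := h.right (k + i) (by omega)
    rw [normMap_fst hev, normMap_fst hev, Nat.add_sub_cancel' hlt.le]
    omega

theorem isCutPath_of_isBridgePath {w : ℕ → ℤ × ℤ} {n k : ℕ} (hkn : k < n)
    (h₁ : IsBridgePath w k) (h₂ : IsBridgePath (fun i => normMap (w k) (w (k + i))) (n - k)) :
    IsCutPath w n k := by
  refine ⟨h₁.pos, hkn, h₁.last, h₁.right, ?_⟩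
  intro i hi hin
  have := h₂.left (i - k) (by omega) (by omega)
  rw [normMap_fst h₁.last_eq.1, Nat.add_sub_cancel' hi.le] at this
  omega

/-- The concatenation of two bridges is a bridge. -/
theorem IsBridgePath.append {w : ℕ → ℤ × ℤ} {n k : ℕ} (hkn : k < n)
    (h₁ : IsBridgePath w k) (h₂ : IsBridgePath (fun i => normMap (w k) (w (k + i))) (n - k)) :
    IsBridgePath w n := by
  have hk := isCutPath_of_isBridgePath hkn h₁ h₂
  have hp := h₁.pos
  obtain ⟨hev, hlast⟩ := h₁.last_eq
  have hnext : w (k + 1) = w k + (1, 0) := by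
    have := h₂.one
    simp only [Prod.ext_iff, normMap_fst hev, normMap_snd hev] at this
    obtain ⟨h1, h2⟩ := this
    ext
    · simp only [Prod.fst_add]
      omega
    · simp only [Prod.snd_add]
      split_ifs at h2 <;> omega
  have hturn : ¬ perp (w k - w (k - 1)) (w (k + 1) - w k) := by
    rw [hnext, hlast]
    simp [perp]
  refine ⟨by omega, h₁.zero, h₁.one, ?_, ?_, ?_, ?_, ?_, ?_⟩
  · intro i j hij hj he
    rcases le_or_gt j k with hjk | hjk
    · exact h₁.ne i j hij hjk he
    rcases lt_or_ge i k with hik | hik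
    · have h3 := h₁.right i hik.le
      have h4 := hk.after j hjk hj
      rw [he] at h3
      omega
    · refine h₂.ne (i - k) (j - k) (by omega) (by omega) ?_
      simp only [Nat.add_sub_cancel' hik, Nat.add_sub_cancel' hjk.le, he]
  · intro i hi
    rcases lt_or_ge i k with hik | hik
    · exact h₁.step i hik
    · have := h₂.step (i - k) (by omega)
      rw [taxiStep_normMap_iff hev, Nat.add_sub_cancel' hik,
        show k + (i - k + 1) = i + 1 by omega] at this
      exact this
  · intro i hi
    rcases le_or_gt (i + 3) k with hik | hik
    · exact h₁.not_turn i hik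
    rcases le_or_gt k i with hki | hki
    · have := h₂.not_turn (i - k) (by omega)
      simp only [perp_normMap_iff hev] at this
      rw [Nat.add_sub_cancel' hki, show k + (i - k + 1) = i + 1 by omega,
        show k + (i - k + 2) = i + 2 by omega, show k + (i - k + 3) = i + 3 by omega] at this
      exact this
    rintro ⟨h3, h4⟩
    obtain rfl | rfl : k = i + 1 ∨ k = i + 2 := by omega
    · exact hturn h3
    · exact hturn h4
  · intro i h1 hi
    rcases le_or_gt i k with hik | hik
    · exact h₁.left i h1 hik
    · have h3 := h₁.left k hp le_rfl
      have h4 := hk.after i hik hi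
      omega
  · have := h₂.last
    rw [normMap_snd_eq_iff hev, Nat.add_sub_cancel' hkn.le,
      show k + (n - k - 1) = n - 1 by omega] at this
    exact this
  · intro i hi
    rcases le_or_gt i k with hik | hik
    · have h3 := h₁.right i hik
      have h4 := hk.after n hkn le_rfl
      omega
    · have := h₂.right (i - k) (by omega)
      rw [normMap_fst hev, normMap_fst hev, Nat.add_sub_cancel' hkn.le,
        Nat.add_sub_cancel' hik.le] at this
      omega

theorem IsCutPath.iff_left {w : ℕ → ℤ × ℤ} {n k : ℕ} (hk : IsCutPath w n k) {j : ℕ} (hj : j < k) :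
    IsCutPath w k j ↔ IsCutPath w n j := by
  have := hk.lt
  refine ⟨fun h => ⟨h.pos, by omega, h.last, h.before, fun i hi hin => ?_⟩,
    fun h => ⟨h.pos, hj, h.last, h.before, fun i hi hik => h.after i hi (by omega)⟩⟩
  rcases le_or_gt i k with hik | hik
  · exact h.after i hi hik
  · exact (h.after k hj le_rfl).trans (hk.after i hik hin)

theorem IsCutPath.congr {w w' : ℕ → ℤ × ℤ} {n k : ℕ} (h : IsCutPath w n k)
    (hw : ∀ i, i ≤ n → w i = w' i) : IsCutPath w' n k := by
  have := h.lt
  refine ⟨h.pos, h.lt, ?_, ?_, ?_⟩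
  · rw [← hw k (by omega), ← hw (k - 1) (by omega)]
    exact h.last
  · intro i hi
    rw [← hw k (by omega), ← hw i (by omega)]
    exact h.before i hi
  · intro i hi hin
    rw [← hw k (by omega), ← hw i (by omega)]
    exact h.after i hi hin

theorem getD_take_of_le (l : List (ℤ × ℤ)) {i k : ℕ} (hi : i ≤ k) :
    (l.take (k + 1)).getD i 0 = l.getD i 0 := by
  simp [List.getD_eq_getElem?_getD, Nat.lt_succ_of_le hi]

theorem isBridge_take_iff {l : List (ℤ × ℤ)} {k : ℕ} (hk : k < l.length) :
    IsBridge (l.take (k + 1)) ↔ IsBridgePath (fun i => l.getD i 0) k := by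
  rw [isBridge_iff_isBridgePath _ k (by rw [List.length_take]; omega)]
  exact ⟨fun h => h.congr fun i hi => getD_take_of_le l hi,
    fun h => h.congr fun i hi => (getD_take_of_le l hi).symm⟩

theorem isBridge_map_drop_iff {l : List (ℤ × ℤ)} {k n : ℕ} (hl : l.length = n + 1) (hk : k ≤ n)
    (f : ℤ × ℤ → ℤ × ℤ) :
    IsBridge ((l.drop k).map f) ↔ IsBridgePath (fun i => f (l.getD (k + i) 0)) (n - k) := by
  have key : ∀ i, i ≤ n - k → ((l.drop k).map f).getD i 0 = f (l.getD (k + i) 0) := by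
    intro i hi
    rw [List.getD_eq_getElem _ _ (by simp; omega), List.getD_eq_getElem _ _ (by omega)]
    simp
  rw [isBridge_iff_isBridgePath _ (n - k) (by simp; omega)]
  exact ⟨fun h => h.congr key, fun h => h.congr fun i hi => (key i hi).symm⟩

theorem isCutAt_iff_isCutPath {l : List (ℤ × ℤ)} {n : ℕ} (hl : l.length = n + 1) (h : IsBridge l)
    (k : ℕ) : IsCutAt l k ↔ IsCutPath (fun i => l.getD i 0) n k := by
  rw [isBridge_iff_isBridgePath l n hl] at h
  constructor
  · rintro ⟨-, hk, h₁, -, h₂⟩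
    rw [isBridge_take_iff (by omega)] at h₁
    rw [isBridge_map_drop_iff hl (by omega)] at h₂
    exact isCutPath_of_isBridgePath (by omega) h₁ h₂
  · intro hk
    have := hk.lt
    exact ⟨hk.pos, by omega, (isBridge_take_iff (by omega)).2 (hk.isBridgePath_left h),
      hk.step_eq h, (isBridge_map_drop_iff hl (by omega) _).2 (hk.isBridgePath_right h)⟩

/-- A bridge concatenated from two bridges has a cutvertex at the joint. -/
theorem isBridge_and_isCutAt_of_split {l : List (ℤ × ℤ)} {n k : ℕ} (hl : l.length = n + 1)
    (hk : k < n) (h₁ : IsBridge (l.take (k + 1)))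
    (h₂ : IsBridge ((l.drop k).map (normMap (l.getD k 0)))) : IsBridge l ∧ IsCutAt l k := by
  rw [isBridge_take_iff (by omega)] at h₁
  rw [isBridge_map_drop_iff hl hk.le] at h₂
  have h := (isBridge_iff_isBridgePath l n hl).2 (h₁.append hk h₂)
  exact ⟨h, (isCutAt_iff_isCutPath hl h k).2 (isCutPath_of_isBridgePath hk h₁ h₂)⟩

theorem isIrreducibleBridge_take_iff {l : List (ℤ × ℤ)} {k : ℕ} (h : IsBridge l)
    (hk : IsCutAt l k) :
    IsIrreducibleBridge (l.take (k + 1)) ↔ ∀ j, j < k → ¬ IsCutAt l j := by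
  obtain ⟨n, hl⟩ : ∃ n, l.length = n + 1 := ⟨l.length - 1, by have := hk.2.1; omega⟩
  have hkn : k < n := by have := hk.2.1; omega
  have hb : IsBridge (l.take (k + 1)) := hk.2.2.1
  have hlt : (l.take (k + 1)).length = k + 1 := by rw [List.length_take]; omega
  rw [isCutAt_iff_isCutPath hl h] at hk
  simp only [IsIrreducibleBridge, hb, true_and, isCutAt_iff_isCutPath hlt hb,
    isCutAt_iff_isCutPath hl h]
  constructor
  · exact fun H j hj hc => H j (((hk.iff_left hj).2 hc).congr
      fun i hi => (getD_take_of_le l hi).symm)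
  · intro H j hc
    have hc' := hc.congr fun i hi => getD_take_of_le l hi
    exact H j hc'.lt ((hk.iff_left hc'.lt).1 hc')

/-- The bridges of length `n`. -/
def bridges (n : ℕ) : Set (List (ℤ × ℤ)) := {l | IsBridge l ∧ l.length = n + 1}

/-- The irreducible bridges of length `n`. -/
def irrBridges (n : ℕ) : Set (List (ℤ × ℤ)) := {l | IsIrreducibleBridge l ∧ l.length = n + 1}

/-- The bridges of length `n` whose first cutvertex has index `k`. -/
def bridgesWithFirstCut (n k : ℕ) : Set (List (ℤ × ℤ)) :=
  {l ∈ bridges n | IsCutAt l k ∧ ∀ j, j < k → ¬ IsCutAt l j}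

theorem abs_le_of_mem_bridges {n : ℕ} {l : List (ℤ × ℤ)} (hl : l ∈ bridges n) (i : ℕ)
    (hi : i ≤ n) : |(l.getD i 0).1| ≤ i ∧ |(l.getD i 0).2| ≤ i := by
  have h := (isBridge_iff_isBridgePath l n hl.2).1 hl.1
  induction i with
  | zero =>
    have : l.getD 0 0 = (0, 0) := h.zero
    rw [this]
    simp
  | succ i ih =>
    have hs := h.step i hi
    have := ih (by omega)
    simp only [taxiStep, Prod.ext_iff, abs_le] at hs this ⊢
    push_cast
    omega

theorem bridges_finite (n : ℕ) : (bridges n).Finite := by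
  refine (Set.finite_range fun f : Fin (n + 1) → Finset.Icc (-n : ℤ) n ×ˢ Finset.Icc (-n : ℤ) n =>
    List.ofFn fun i => (f i : ℤ × ℤ)).subset ?_
  intro l hl
  have hlen : l.length = n + 1 := hl.2
  refine ⟨fun i => ⟨l.getD i 0, ?_⟩, ?_⟩
  · have := abs_le_of_mem_bridges hl i (by omega)
    have hi := i.2
    simp only [abs_le] at this
    simp only [Finset.mem_product, Finset.mem_Icc]
    omega
  · apply List.ext_getElem
    · simp [hlen]
    · intro i h1 h2
      rw [List.getElem_ofFn]
      exact List.getD_eq_getElem l 0 h2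

theorem irrBridges_subset_bridges (n : ℕ) : irrBridges n ⊆ bridges n := fun _ hl => ⟨hl.1.1, hl.2⟩

theorem even_snd_of_mem_bridges {n : ℕ} {l : List (ℤ × ℤ)} (hl : l ∈ bridges n) :
    Even (l.getD n 0).2 :=
  ((isBridge_iff_isBridgePath l n hl.2).1 hl.1).last_eq.1

theorem ncard_bridgesWithFirstCut {n k : ℕ} (hkn : k < n) :
    (bridgesWithFirstCut n k).ncard = (irrBridges k).ncard * (bridges (n - k)).ncard := by
  rw [← Set.ncard_prod]
  refine Set.ncard_congr
    (fun l _ => (l.take (k + 1), (l.drop k).map (normMap (l.getD k 0)))) ?_ ?_ ?_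
  · rintro l ⟨⟨hb, hlen⟩, hk, hmin⟩
    refine ⟨⟨(isIrreducibleBridge_take_iff hb hk).2 hmin, ?_⟩, hk.2.2.2.2, ?_⟩
    · simp only [List.length_take]
      omega
    · simp only [List.length_map, List.length_drop]
      omega
  · rintro l l' ⟨⟨hb, hlen⟩, hk, -⟩ - he
    obtain ⟨h1, h2⟩ := Prod.ext_iff.1 he
    simp only at h1 h2
    have hv : l.getD k 0 = l'.getD k 0 := by
      rw [← getD_take_of_le l le_rfl, h1, getD_take_of_le l' le_rfl]
    have hev : Even (l.getD k 0).2 := by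
      rw [← getD_take_of_le l le_rfl]
      exact even_snd_of_mem_bridges ⟨hk.2.2.1, by rw [List.length_take]; omega⟩
    rw [← hv] at h2
    have h3 := List.map_injective_iff.2 (normMap_injective hev) h2
    have h4 := congrArg (List.take k) h1
    simp only [List.take_take, Nat.min_eq_left k.le_succ] at h4
    rw [← List.take_append_drop k l, h3, h4, List.take_append_drop]
  · rintro ⟨l₁, l₂⟩ ⟨⟨hirr, hlen₁⟩, hb₂, hlen₂⟩
    simp only at hirr hlen₁ hb₂ hlen₂
    set p := l₁.getD k 0 with hp
    have hev : Even p.2 := even_snd_of_mem_bridges ⟨hirr.1, hlen₁⟩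
    obtain ⟨t, rfl⟩ : ∃ t, l₂ = (0, 0) :: t := by
      cases l₂ with
      | nil => simp at hlen₂
      | cons a t =>
        have := hb₂.2.2.1
        simp only [List.getD_cons_zero] at this
        exact ⟨t, by rw [this]⟩
    rw [List.length_cons] at hlen₂
    have htake : (l₁ ++ t.map (denormMap p)).take (k + 1) = l₁ := List.take_left' hlen₁
    have hgetD : (l₁ ++ t.map (denormMap p)).getD k 0 = p := by
      rw [← getD_take_of_le _ le_rfl, htake]
    have hdrop : (l₁ ++ t.map (denormMap p)).drop k = p :: t.map (denormMap p) := by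
      rw [List.drop_append_of_le_length (by omega), List.drop_eq_getElem_cons (by omega),
        List.drop_of_length_le (by omega), hp, List.getD_eq_getElem _ _ (by omega)]
      rfl
    have hmap : (p :: t.map (denormMap p)).map (normMap p) = (0, 0) :: t := by
      have : normMap p ∘ denormMap p = id := funext (normMap_denormMap hev)
      rw [List.map_cons, normMap_self, List.map_map, this, List.map_id]
    have hlen : (l₁ ++ t.map (denormMap p)).length = n + 1 := by
      rw [List.length_append, List.length_map]
      omega
    obtain ⟨hb, hk⟩ := isBridge_and_isCutAt_of_split hlen hkn (by rw [htake]; exact hirr.1)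
      (by rw [hgetD, hdrop, hmap]; exact hb₂)
    refine ⟨l₁ ++ t.map (denormMap p),
      ⟨⟨hb, hlen⟩, hk, (isIrreducibleBridge_take_iff hb hk).1 (by rwa [htake])⟩, ?_⟩
    rw [hgetD, hdrop, hmap, htake]

theorem bridges_succ_eq (n : ℕ) :
    bridges (n + 1) = irrBridges (n + 1) ∪ ⋃ k : Fin n, bridgesWithFirstCut (n + 1) (k + 1) := by
  classical
  ext l
  simp only [Set.mem_union, Set.mem_iUnion]
  constructor
  · intro hl
    by_cases h : ∃ k, IsCutAt l k
    · right
      have hk := Nat.find_spec h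
      have hpos := hk.1
      have hlt := hk.2.1
      rw [hl.2] at hlt
      refine ⟨⟨Nat.find h - 1, by omega⟩, hl, ?_⟩
      simp only [Nat.sub_add_cancel hpos]
      exact ⟨hk, fun j hj => Nat.find_min h hj⟩
    · exact Or.inl ⟨⟨hl.1, not_exists.1 h⟩, hl.2⟩
  · rintro (hl | ⟨k, hl⟩)
    · exact irrBridges_subset_bridges _ hl
    · exact hl.1

theorem bridgesWithFirstCut_disjoint (n : ℕ) {j k : ℕ} (hjk : j ≠ k) :
    Disjoint (bridgesWithFirstCut n j) (bridgesWithFirstCut n k) := by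
  rw [Set.disjoint_left]
  intro l hj hk
  rcases hjk.lt_or_gt with h | h
  · exact hk.2.2 j h hj.2.1
  · exact hj.2.2 k h hk.2.1

theorem ncard_bridges_succ (n : ℕ) :
    (bridges (n + 1)).ncard = (irrBridges (n + 1)).ncard +
      ∑ k : Fin n, (irrBridges (k + 1)).ncard * (bridges (n - k)).ncard := by
  have hfin : ∀ k : Fin n, (bridgesWithFirstCut (n + 1) (k + 1)).Finite :=
    fun k => (bridges_finite (n + 1)).subset fun _ hl => hl.1
  rw [bridges_succ_eq, Set.ncard_union_eq _
    ((bridges_finite (n + 1)).subset (irrBridges_subset_bridges _)) (Set.finite_iUnion hfin),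
    Set.ncard_iUnion_of_finite hfin, finsum_eq_sum_of_fintype]
  · congr 1
    refine Finset.sum_congr rfl fun k _ => ?_
    rw [ncard_bridgesWithFirstCut (by omega), Nat.add_sub_add_right]
  · intro j k hjk
    exact bridgesWithFirstCut_disjoint _ (by simpa [Fin.ext_iff] using hjk)
  · rw [Set.disjoint_iUnion_right]
    refine fun k => Set.disjoint_left.2 fun l hl hk => hl.1.2 _ hk.2.1

theorem bridgeCount_eq_ncard {n : ℕ} (hn : n ≠ 0) : bridgeCount n = (bridges n).ncard := by
  obtain ⟨n, rfl⟩ := Nat.exists_eq_succ_of_ne_zero hn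
  rfl

/-- The renewal equation for bridges, obtained by cutting at the first cutvertex. -/
theorem bridgeCount_succ (n : ℕ) :
    bridgeCount (n + 1) = ∑ k : Fin (n + 1), irrBridgeCount (k + 1) * bridgeCount (n - k) := by
  rw [Fin.sum_univ_castSucc, bridgeCount_eq_ncard n.succ_ne_zero, ncard_bridges_succ, add_comm]
  congr 1
  · refine Finset.sum_congr rfl fun k _ => ?_
    rw [Fin.val_castSucc, bridgeCount_eq_ncard (by omega)]
    rfl
  · simp only [Fin.val_last, Nat.sub_self]
    exact (mul_one _).symm

/-- Prepend the block `k + 1` to a composition of `n - k`. -/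
def Composition.consBlock (n : ℕ) (x : Σ k : Fin (n + 1), Composition (n - k)) :
    Composition (n + 1) where
  blocks := (x.1 + 1) :: x.2.blocks
  blocks_pos := by
    intro i hi
    rcases List.mem_cons.1 hi with rfl | hi
    · exact Nat.succ_pos _
    · exact x.2.blocks_pos hi
  blocks_sum := by
    rw [List.sum_cons, x.2.blocks_sum]
    omega

theorem Composition.consBlock_bijective (n : ℕ) :
    Function.Bijective (Composition.consBlock n) := by
  constructor
  · rintro ⟨k, c⟩ ⟨k', c'⟩ h
    have hb := congrArg Composition.blocks h
    simp only [consBlock, List.cons.injEq] at hb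
    obtain rfl : k = k' := Fin.ext (by omega)
    rw [Composition.ext hb.2]
  · rintro ⟨_ | ⟨k, t⟩, hpos, hsum⟩
    · simp at hsum
    have hk : 0 < k := hpos List.mem_cons_self
    rw [List.sum_cons] at hsum
    refine ⟨⟨⟨k - 1, by omega⟩, ⟨t, fun hi => hpos (List.mem_cons_of_mem _ hi), ?_⟩⟩, ?_⟩
    · simp only
      omega
    · ext1
      simp only [consBlock, Nat.sub_add_cancel hk]

theorem Composition.sum_prod_blocks_succ {R : Type*} [CommSemiring R] (a : ℕ → R) (n : ℕ) :
    ∑ c : Composition (n + 1), (c.blocks.map a).prod =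
      ∑ k : Fin (n + 1), a (k + 1) * ∑ c : Composition (n - k), (c.blocks.map a).prod := by
  rw [← (Composition.consBlock_bijective n).sum_comp fun c => (c.blocks.map a).prod,
    Fintype.sum_sigma]
  simp only [consBlock, List.map_cons, List.prod_cons, Finset.mul_sum]

theorem bridgeCount_eq_sum_prod_blocks (n : ℕ) :
    bridgeCount n = ∑ c : Composition n, (c.blocks.map irrBridgeCount).prod := by
  induction n using Nat.strong_induction_on with
  | _ n ih =>
    cases n with
    | zero =>
      have : ∀ c : Composition 0, c.blocks = [] := fun c => c.blocks_eq_nil.2 rfl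
      simp [this, composition_card, bridgeCount]
    | succ n =>
      rw [bridgeCount_succ, Composition.sum_prod_blocks_succ]
      exact Finset.sum_congr rfl fun k _ => by rw [ih (n - k) (by omega)]

/-- For every `n ≥ 1`,
`b_n = Σ_{ℓ ≥ 1} Σ_{k_1 + ⋯ + k_ℓ = n, k_i ≥ 1} Π_{i=1}^{ℓ} a_{k_i}`,
the sum being over all compositions of `n` into positive parts: every bridge decomposes
uniquely as a concatenation (with normalizing symmetries applied) of irreducible bridges. -/
theorem bridgeCount_eq_sum_over_compositions (n : ℕ) (hn : 1 ≤ n) :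
    bridgeCount n = ∑ c : Composition n, (c.blocks.map irrBridgeCount).prod := by
  exact bridgeCount_eq_sum_prod_blocks n
end

section
/- Let x > 0 be a real number and let (a'_n)_{n≥1} be a sequence of nonnegative integers with a'_n ≤ a_n for every n. If Σ_{n=1}^{∞} a'_n x^n > 1 (equivalently, some finite partial sum Σ_{n=1}^{N} a'_n x^n exceeds 1), then μ_taxi > 1/x. -/
open Filter

/-- A taxi walk from the origin whose later vertices all have abscissa `≥ 1`. -/
def IsHalfPlaneWalk (l : List (ℤ × ℤ)) : Prop :=
  IsTaxiWalk l ∧ l.getD 0 0 = 0 ∧ ∀ i, 1 ≤ i → i < l.length → 1 ≤ (l.getD i 0).1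

/-- The set of half-plane walks of length `n`. -/
def halfPlaneWalks (n : ℕ) : Set (List (ℤ × ℤ)) :=
  {l | IsHalfPlaneWalk l ∧ l.length = n + 1}

/-- The set of irreducible bridges of length `n`. -/
def irreducibleBridges (n : ℕ) : Set (List (ℤ × ℤ)) :=
  {l | IsIrreducibleBridge l ∧ l.length = n + 1}

lemma irrBridgeCount_eq_ncard {n : ℕ} (hn : 1 ≤ n) :
    irrBridgeCount n = (irreducibleBridges n).ncard := by
  obtain ⟨m, rfl⟩ : ∃ m, n = m + 1 := ⟨n - 1, by omega⟩
  rfl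

/-! ### Finiteness -/

lemma taxiStep.abs_le {u v : ℤ × ℤ} (h : taxiStep u v) :
    |v.1| ≤ |u.1| + 1 ∧ |v.2| ≤ |u.2| + 1 := by
  rcases h with ⟨-, rfl⟩ | ⟨-, rfl⟩ | ⟨-, rfl⟩ | ⟨-, rfl⟩ <;> grind

lemma abs_getD_le {l : List (ℤ × ℤ)} (hl : IsTaxiWalk l) (h0 : l.getD 0 0 = 0) (i : ℕ)
    (hi : i < l.length) : |(l.getD i 0).1| ≤ i ∧ |(l.getD i 0).2| ≤ i := by
  induction i with
  | zero => rw [h0]; simp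
  | succ i ih =>
    have h1 := ih (by omega)
    have h2 := (hl.2.2.1 i hi).abs_le
    push_cast
    omega

lemma finite_lists_of_finite {α : Type*} {s : Set α} (hs : s.Finite) (n : ℕ) :
    {l : List α | l.length = n ∧ ∀ a ∈ l, a ∈ s}.Finite := by
  have := hs.to_subtype
  refine ((List.finite_length_eq s n).image (List.map Subtype.val)).subset ?_
  rintro l ⟨hl, hmem⟩
  lift l to List s using hmem
  exact ⟨l, by simpa using hl, rfl⟩

lemma originWalks_finite (n : ℕ) : (originWalks n).Finite := by
  refine (finite_lists_of_finite
    (Set.finite_Icc ((-n, -n) : ℤ × ℤ) ((n, n) : ℤ × ℤ)) (n + 1)).subset ?_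
  rintro l ⟨hl, hlen, h0⟩
  refine ⟨hlen, fun a ha => ?_⟩
  obtain ⟨i, hi, rfl⟩ := List.getElem_of_mem ha
  have h := abs_getD_le hl h0 i hi
  rw [List.getD_eq_getElem _ _ hi, abs_le, abs_le] at h
  simp only [Set.mem_Icc, Prod.le_def]
  omega

lemma halfPlaneWalks_subset_originWalks (n : ℕ) : halfPlaneWalks n ⊆ originWalks n :=
  fun _ hl => ⟨hl.1.1, hl.2, hl.1.2.1⟩

lemma halfPlaneWalks_finite (n : ℕ) : (halfPlaneWalks n).Finite :=
  (originWalks_finite n).subset (halfPlaneWalks_subset_originWalks n)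

lemma IsBridge.isHalfPlaneWalk {l : List (ℤ × ℤ)} (hl : IsBridge l) : IsHalfPlaneWalk l :=
  ⟨hl.1, hl.2.2.1, hl.2.2.2.2.1⟩

lemma irreducibleBridges_finite (n : ℕ) : (irreducibleBridges n).Finite :=
  (halfPlaneWalks_finite n).subset fun _ hl => ⟨hl.1.1.isHalfPlaneWalk, hl.2⟩

/-! ### Steps at the two ends -/

lemma IsHalfPlaneWalk.getD_one {l : List (ℤ × ℤ)} (hl : IsHalfPlaneWalk l) (h : 1 < l.length) :
    l.getD 1 0 = (1, 0) := by
  have h1 := hl.1.2.2.1 0 h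
  have h2 := hl.2.2 1 le_rfl h
  rw [hl.2.1] at h1
  rcases h1 with ⟨-, h1⟩ | ⟨h0, -⟩ | ⟨-, h1⟩ | ⟨h0, -⟩
  · simpa using h1
  · simp at h0
  · rw [zero_add] at h1; rw [h1] at h2; simp at h2
  · simp at h0

lemma IsBridge.last_step {l : List (ℤ × ℤ)} (hl : IsBridge l) {n : ℕ} (hn : l.length = n + 1) :
    1 ≤ n ∧ Even (l.getD n 0).2 ∧ l.getD n 0 = l.getD (n - 1) 0 + (1, 0) := by
  obtain ⟨ht, h2, -, -, -, hlast, hmax⟩ := hl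
  have hn1 : 1 ≤ n := by omega
  have hs := ht.2.2.1 (n - 1) (by omega)
  have hm := hmax (n - 1) (by omega)
  rw [hn, Nat.add_sub_cancel] at hm
  rw [hn, Nat.add_sub_cancel, show n + 1 - 2 = n - 1 by omega] at hlast
  rw [Nat.sub_add_cancel hn1] at hs
  refine ⟨hn1, ?_⟩
  rcases hs with ⟨he, hs⟩ | ⟨-, hs⟩ | ⟨-, hs⟩ | ⟨-, hs⟩
  · refine ⟨by rw [hlast]; exact he, ?_⟩
    rw [hs]; ext <;> simp
  all_goals rw [hs] at hm hlast; simp at hm hlast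

/-! ### The inverse of the normalizing symmetry -/

/-- The inverse of `normMap p` when `p.2` is even. -/
def placeMap (p q : ℤ × ℤ) : ℤ × ℤ :=
  (q.1 + p.1, if Even p.1 then p.2 + q.2 else p.2 - q.2)

lemma normMap_placeMap {p : ℤ × ℤ} (hp : Even p.2) (q : ℤ × ℤ) :
    normMap p (placeMap p q) = q := by
  unfold normMap placeMap
  ext <;> grind

lemma placeMap_injective {p : ℤ × ℤ} (hp : Even p.2) : Function.Injective (placeMap p) :=
  Function.LeftInverse.injective (normMap_placeMap hp)

lemma placeMap_zero (p : ℤ × ℤ) : placeMap p 0 = p := by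
  unfold placeMap
  ext <;> simp

lemma placeMap_one_zero (p : ℤ × ℤ) : placeMap p (1, 0) = p + (1, 0) := by
  unfold placeMap
  ext <;> simp [add_comm]

lemma taxiStep.placeMap {p u v : ℤ × ℤ} (hp : Even p.2) (h : taxiStep u v) :
    taxiStep (placeMap p u) (placeMap p v) := by
  obtain ⟨p1, p2⟩ := p
  obtain ⟨u1, u2⟩ := u
  unfold taxiStep _root_.placeMap
  simp only [Prod.mk.injEq] at hp ⊢
  by_cases h1 : Even p1
  · rcases h with ⟨he, rfl⟩ | ⟨he, rfl⟩ | ⟨he, rfl⟩ | ⟨he, rfl⟩ <;> simp only [if_pos h1] <;> grind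
  · rcases h with ⟨he, rfl⟩ | ⟨he, rfl⟩ | ⟨he, rfl⟩ | ⟨he, rfl⟩ <;> simp only [if_neg h1] <;> grind

lemma perp_placeMap_iff (p a b c d : ℤ × ℤ) :
    perp (placeMap p a - placeMap p b) (placeMap p c - placeMap p d) ↔ perp (a - b) (c - d) := by
  unfold perp placeMap
  split_ifs <;> simp only [Prod.fst_sub, Prod.snd_sub] <;> ring_nf

/-! ### Concatenation -/

/-- The concatenation of a bridge `β` of length `n` with a walk `γ` starting at the origin. -/
def concatWalk (n : ℕ) (β γ : List (ℤ × ℤ)) : List (ℤ × ℤ) :=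
  β ++ γ.tail.map (placeMap (β.getD n 0))

section concat

variable {n : ℕ} {β γ : List (ℤ × ℤ)}

lemma length_concatWalk (hn : β.length = n + 1) (hγ : γ ≠ []) :
    (concatWalk n β γ).length = n + γ.length := by
  have := List.length_pos_iff.2 hγ
  simp [concatWalk, hn]
  omega

lemma getD_concatWalk_left (hn : β.length = n + 1) {i : ℕ} (hi : i ≤ n) :
    (concatWalk n β γ).getD i 0 = β.getD i 0 :=
  List.getD_append _ _ _ _ (by omega)

lemma concatWalk_drop (hn : β.length = n + 1) (hγ : γ ≠ []) (h0 : γ.getD 0 0 = 0) :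
    (concatWalk n β γ).drop n = γ.map (placeMap (β.getD n 0)) := by
  obtain ⟨a, t, rfl⟩ := List.exists_cons_of_ne_nil hγ
  obtain rfl : a = 0 := h0
  have h1 : β.drop n = [β.getD n 0] := by
    rw [List.drop_eq_getElem_cons (by omega), List.getD_eq_getElem _ _ (by omega),
      List.drop_eq_nil_of_le (by omega)]
  rw [concatWalk, List.drop_append_of_le_length (by omega), h1]
  simp [placeMap_zero]

lemma getD_concatWalk_right (hn : β.length = n + 1) (h0 : γ.getD 0 0 = 0)
    {j : ℕ} (hj : j < γ.length) :
    (concatWalk n β γ).getD (n + j) 0 = placeMap (β.getD n 0) (γ.getD j 0) := by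
  have hγ : γ ≠ [] := List.ne_nil_of_length_pos (by omega)
  have hl := length_concatWalk (γ := γ) hn hγ
  have h := concatWalk_drop hn hγ h0
  have h1 : ((concatWalk n β γ).drop n)[j]? = (γ.map (placeMap (β.getD n 0)))[j]? := by rw [h]
  rw [List.getElem?_drop, List.getElem?_map, List.getElem?_eq_getElem hj,
    Option.map_some] at h1
  rw [List.getD_eq_getElem?_getD, h1, List.getD_eq_getElem _ _ hj, Option.getD_some]

lemma concatWalk_take (hn : β.length = n + 1) : (concatWalk n β γ).take (n + 1) = β := by
  rw [concatWalk, ← hn, List.take_left]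

lemma isHalfPlaneWalk_concatWalk (hn : β.length = n + 1) (hβ : IsBridge β)
    (hγ : IsHalfPlaneWalk γ) : IsHalfPlaneWalk (concatWalk n β γ) := by
  obtain ⟨hn1, heven, hstep⟩ := hβ.last_step hn
  have hne : γ ≠ [] := hγ.1.1
  have hpos := List.length_pos_iff.2 hne
  have hlen := length_concatWalk (γ := γ) hn hne
  have hR : ∀ {j}, j < γ.length → _ := fun {j} hj => getD_concatWalk_right (j := j) hn hγ.2.1 hj
  have hL : ∀ {i}, i ≤ n → _ := fun {i} hi => getD_concatWalk_left (γ := γ) (i := i) hn hi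
  have hmax : ∀ i, i ≤ n → (β.getD i 0).1 ≤ (β.getD n 0).1 := by
    intro i hi
    have := hβ.2.2.2.2.2.2 i (by omega)
    rwa [hn, Nat.add_sub_cancel] at this
  have hcut : 1 < γ.length → ¬ turnAt (concatWalk n β γ) n := by
    intro h1
    unfold turnAt
    rw [hR h1, hL le_rfl, hL (Nat.sub_le n 1), hγ.getD_one h1, placeMap_one_zero, hstep]
    simp [perp]
  refine ⟨⟨?_, ?_, ?_, ?_⟩, ?_, ?_⟩
  · exact List.ne_nil_of_length_pos (by omega)
  · rw [concatWalk, List.nodup_append]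
    refine ⟨hβ.1.2.1, (hγ.1.2.1.sublist (List.tail_sublist γ)).map (placeMap_injective heven), ?_⟩
    rintro a ha b hb rfl
    obtain ⟨i, hi, rfl⟩ := List.getElem_of_mem ha
    obtain ⟨q, hq, hqe⟩ := List.mem_map.1 hb
    obtain ⟨j, hj, rfl⟩ := List.getElem_of_mem hq
    have hj' : j + 1 < γ.length := by simp at hj; omega
    have h1 := hmax i (by omega)
    have h2 := hγ.2.2 (j + 1) (by omega) hj'
    rw [List.getD_eq_getElem _ _ hi, ← hqe] at h1
    rw [List.getD_eq_getElem _ _ hj'] at h2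
    simp only [placeMap, List.getElem_tail] at h1
    omega
  · intro i hi
    rcases lt_or_ge i n with h | h
    · rw [hL h.le, hL h]
      exact hβ.1.2.2.1 i (by omega)
    · obtain ⟨j, rfl⟩ := Nat.exists_eq_add_of_le h
      rw [add_assoc, hR (by omega), hR (by omega)]
      exact (hγ.1.2.2.1 j (by omega)).placeMap heven
  · intro i hi hi2 hturn
    rcases lt_trichotomy (i + 1) n with h | h | h
    · refine hβ.1.2.2.2 i hi (by omega) ?_
      unfold turnAt at hturn ⊢
      rwa [hL (by omega), hL (by omega), hL (by omega), hL (by omega), hL (by omega)] at hturn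
    · exact hcut (by omega) (h ▸ hturn.2)
    · obtain ⟨j, rfl⟩ := Nat.exists_eq_add_of_le (show n ≤ i by omega)
      rcases Nat.eq_zero_or_pos j with rfl | hj
      · exact hcut (by omega) hturn.1
      · refine hγ.1.2.2.2 j hj (by omega) ?_
        unfold turnAt at hturn ⊢
        rw [show n + j - 1 = n + (j - 1) by omega, show n + j + 1 - 1 = n + j by omega,
          show n + j + 1 + 1 = n + (j + 1 + 1) by omega, show n + j + 1 = n + (j + 1) by omega,
          hR (by omega), hR (by omega), hR (by omega), hR (by omega), perp_placeMap_iff,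
          perp_placeMap_iff] at hturn
        rwa [Nat.add_sub_cancel]
  · rw [hL (Nat.zero_le n)]
    exact hβ.2.2.1
  · intro i hi hi2
    rcases le_or_gt i n with h | h
    · rw [hL h]
      exact hβ.2.2.2.2.1 i hi (by omega)
    · obtain ⟨j, rfl⟩ := Nat.exists_eq_add_of_le h.le
      rw [hR (by omega)]
      have h1 := hγ.2.2 j (by omega) (by omega)
      have h2 := hβ.2.2.2.2.1 n hn1 (by omega)
      simp only [placeMap]
      omega

end concat

/-! ### Uniqueness of the decomposition -/

lemma IsTaxiWalk.take {l : List (ℤ × ℤ)} (hl : IsTaxiWalk l) {m : ℕ} (hm : m < l.length) :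
    IsTaxiWalk (l.take (m + 1)) := by
  have hlen : (l.take (m + 1)).length = m + 1 := by simp; omega
  have hg : ∀ {i}, i ≤ m → (l.take (m + 1)).getD i 0 = l.getD i 0 := by
    intro i hi
    rw [List.getD_eq_getElem _ _ (by omega), List.getD_eq_getElem _ _ (by omega),
      List.getElem_take]
  refine ⟨List.ne_nil_of_length_pos (by omega), hl.2.1.sublist (List.take_sublist _ _), ?_, ?_⟩
  · intro i hi
    rw [hg (by omega), hg (by omega)]
    exact hl.2.2.1 i (by omega)
  · intro i hi hi2
    unfold turnAt
    rw [hg (by omega), hg (by omega), hg (by omega), hg (by omega), hg (by omega)]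
    exact hl.2.2.2 i hi (by omega)

lemma isCutAt_of_concatWalk_eq {n n' : ℕ} {β γ β' γ' : List (ℤ × ℤ)} (hn : β.length = n + 1)
    (hβ : IsBridge β) (hγ : IsHalfPlaneWalk γ) (hn' : β'.length = n' + 1) (hβ' : IsBridge β')
    (hγ' : γ' ≠ []) (h : concatWalk n β γ = concatWalk n' β' γ') (hlt : n < n') :
    IsCutAt β' n := by
  obtain ⟨hn1, heven, -⟩ := hβ.last_step hn
  have hlen := length_concatWalk (γ := γ) hn hγ.1.1
  have hlen' := length_concatWalk (γ := γ') hn' hγ'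
  have hpos' := List.length_pos_iff.2 hγ'
  rw [h] at hlen
  have hL : ∀ {i}, i ≤ n' → (concatWalk n β γ).getD i 0 = β'.getD i 0 := by
    intro i hi
    rw [h, getD_concatWalk_left hn' hi]
  have hR : ∀ {j}, j ≤ n' - n → β'.getD (n + j) 0 = placeMap (β.getD n 0) (γ.getD j 0) := by
    intro j hj
    rw [← hL (by omega), getD_concatWalk_right hn hγ.2.1 (by omega)]
  have hn0 : β'.getD n 0 = β.getD n 0 := by
    rw [← hL hlt.le, getD_concatWalk_left hn le_rfl]
  obtain ⟨m, rfl⟩ := Nat.exists_eq_add_of_lt hlt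
  have hβ'take : β' = (concatWalk n β γ).take (n + m + 1 + 1) := by
    rw [h, concatWalk_take hn']
  have hdrop : (β'.drop n).map (normMap (β'.getD n 0)) = γ.take (m + 1 + 1) := by
    rw [hn0, hβ'take, List.drop_take, concatWalk_drop hn hγ.1.1 hγ.2.1, ← List.map_take,
      List.map_map, show n + m + 1 + 1 - n = m + 1 + 1 by omega]
    have : normMap (β.getD n 0) ∘ placeMap (β.getD n 0) = id :=
      funext (normMap_placeMap heven)
    rw [this, List.map_id]
  have htl : (γ.take (m + 1 + 1)).length = m + 1 + 1 := by simp; omega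
  have hg : ∀ {i}, i ≤ m + 1 → (γ.take (m + 1 + 1)).getD i 0 = γ.getD i 0 := by
    intro i hi
    rw [List.getD_eq_getElem _ _ (by omega), List.getD_eq_getElem _ _ (by omega),
      List.getElem_take]
  refine ⟨hn1, by omega, ?_, ?_, ?_⟩
  · rw [hβ'take, List.take_take, min_eq_left (by omega), concatWalk_take hn]
    exact hβ
  · rw [hR (by omega), hγ.getD_one (by omega), placeMap_one_zero, hn0]
  · rw [hdrop]
    obtain ⟨-, -, -, -, -, hlast, hmax⟩ := hβ'
    refine ⟨hγ.1.take (by omega), by omega, ?_, ?_, ?_, ?_, ?_⟩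
    · rw [hg (by omega)]
      exact hγ.2.1
    · rw [hg (by omega)]
      exact hγ.getD_one (by omega)
    · intro i hi hi2
      rw [hg (by omega)]
      exact hγ.2.2 i hi (by omega)
    · rw [htl, hg (by omega), hg (by omega)]
      rw [hn', show n + m + 1 + 1 - 1 = n + (m + 1) by omega,
        show n + m + 1 + 1 - 2 = n + m by omega, hR (by omega), hR (by omega)] at hlast
      simp only [placeMap] at hlast
      rw [show m + 1 + 1 - 1 = m + 1 by omega, show m + 1 + 1 - 2 = m by omega]
      split_ifs at hlast <;> omega
    · intro i hi
      have h1 := hmax (n + i) (by omega)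
      rw [hn', show n + m + 1 + 1 - 1 = n + (m + 1) by omega, hR (by omega), hR (by omega)] at h1
      simp only [placeMap] at h1
      rw [htl, show m + 1 + 1 - 1 = m + 1 by omega, hg (by omega), hg (by omega)]
      omega

lemma concatWalk_inj {n n' : ℕ} {β γ β' γ' : List (ℤ × ℤ)} (hn : β.length = n + 1)
    (hβ : IsIrreducibleBridge β) (hγ : IsHalfPlaneWalk γ) (hn' : β'.length = n' + 1)
    (hβ' : IsIrreducibleBridge β') (hγ' : IsHalfPlaneWalk γ')
    (h : concatWalk n β γ = concatWalk n' β' γ') : n = n' ∧ β = β' ∧ γ = γ' := by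
  obtain rfl : n = n' := by
    rcases lt_trichotomy n n' with hlt | heq | hlt
    · exact (hβ'.2 n (isCutAt_of_concatWalk_eq hn hβ.1 hγ hn' hβ'.1 hγ'.1.1 h hlt)).elim
    · exact heq
    · exact (hβ.2 n' (isCutAt_of_concatWalk_eq hn' hβ'.1 hγ' hn hβ.1 hγ.1.1 h.symm hlt)).elim
  obtain rfl : β = β' := by
    rw [← concatWalk_take (γ := γ) hn, h, concatWalk_take hn']
  refine ⟨rfl, rfl, List.map_injective_iff.2 (placeMap_injective (hβ.1.last_step hn).2.1) ?_⟩
  rw [← concatWalk_drop hn hγ.1.1 hγ.2.1, h, concatWalk_drop hn hγ'.1.1 hγ'.2.1]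

/-! ### The renewal inequality -/

lemma sum_ncard_mul_ncard_le (s : Finset ℕ) (m : ℕ) (hs : ∀ k ∈ s, k ≤ m) :
    ∑ k ∈ s, (irreducibleBridges k).ncard * (halfPlaneWalks (m - k)).ncard ≤
      (halfPlaneWalks m).ncard := by
  classical
  let I : ℕ → Finset (List (ℤ × ℤ)) := fun k => (irreducibleBridges_finite k).toFinset
  let W : ℕ → Finset (List (ℤ × ℤ)) := fun k => (halfPlaneWalks_finite k).toFinset
  have hI : ∀ k, (irreducibleBridges k).ncard = (I k).card :=
    fun k => Set.ncard_eq_toFinset_card _ _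
  have hW : ∀ k, (halfPlaneWalks k).ncard = (W k).card :=
    fun k => Set.ncard_eq_toFinset_card _ _
  have hsum : ∑ k ∈ s, (irreducibleBridges k).ncard * (halfPlaneWalks (m - k)).ncard =
      (s.sigma fun k => I k ×ˢ W (m - k)).card := by
    rw [Finset.card_sigma]
    exact Finset.sum_congr rfl fun k _ => by rw [hI, hW, Finset.card_product]
  rw [hsum, hW]
  refine Finset.card_le_card_of_injOn (fun t => concatWalk t.1 t.2.1 t.2.2) ?_ ?_
  · rintro ⟨k, β, γ⟩ ht
    simp only [Finset.coe_sigma, Set.mem_sigma_iff, Finset.mem_coe, Finset.mem_product,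
      Set.Finite.mem_toFinset, I, W] at ht ⊢
    obtain ⟨hk, ⟨hβ, hβl⟩, hγ, hγl⟩ := ht
    have := hs k hk
    exact ⟨isHalfPlaneWalk_concatWalk hβl hβ.1 hγ, by
      rw [length_concatWalk hβl hγ.1.1, hγl]; omega⟩
  · rintro ⟨k, β, γ⟩ ht ⟨k', β', γ'⟩ ht' h
    simp only [Finset.coe_sigma, Set.mem_sigma_iff, Finset.mem_coe, Finset.mem_product,
      Set.Finite.mem_toFinset, I, W] at ht ht' h
    obtain ⟨rfl, rfl, rfl⟩ := concatWalk_inj ht.2.1.2 ht.2.1.1 ht.2.2.1 ht'.2.1.2 ht'.2.1.1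
      ht'.2.2.1 h
    rfl

lemma ncard_halfPlaneWalks_zero_pos : 0 < (halfPlaneWalks 0).ncard := by
  rw [Set.ncard_pos (halfPlaneWalks_finite 0)]
  refine ⟨[0], ⟨⟨by simp, by simp, ?_, ?_⟩, by simp, ?_⟩, by simp⟩
  all_goals intro i; simp; try omega

/-! ### Analysis -/

/-- A summable nonnegative sequence with positive initial term cannot satisfy a renewal
inequality whose weights have total mass at least one. -/
lemma sum_lt_one_of_renewal {u p : ℕ → ℝ} (hu : Summable u) (hu0 : 0 < u 0)
    (hun : ∀ n, 0 ≤ u n) (s : Finset ℕ) (hs : ∀ k ∈ s, 1 ≤ k)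
    (hren : ∀ m, 1 ≤ m → ∑ k ∈ s with k ≤ m, p k * u (m - k) ≤ u m) :
    ∑ k ∈ s, p k < 1 := by
  have hshift : ∀ k, HasSum (fun m => if k ≤ m then p k * u (m - k) else 0)
      (p k * ∑' n, u n) := by
    intro k
    rw [← hasSum_nat_add_iff' k]
    have hz : ∑ i ∈ Finset.range k, (if k ≤ i then p k * u (i - k) else 0) = 0 :=
      Finset.sum_eq_zero fun i hi => if_neg (by simpa using hi)
    simpa [hz] using hu.hasSum.mul_left (p k)
  have hL := hasSum_sum fun k (_ : k ∈ s) => hshift k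
  have hR : HasSum (fun m => u m - if m = 0 then u 0 else 0) (∑' n, u n - u 0) :=
    hu.hasSum.sub (hasSum_ite_eq 0 (u 0))
  have hle := hasSum_le (fun m => ?_) hL hR
  · rw [← Finset.sum_mul] at hle
    have hpos : 0 < ∑' n, u n := hu.tsum_pos hun 0 hu0
    by_contra! hge
    nlinarith
  · rw [← Finset.sum_filter]
    rcases Nat.eq_zero_or_pos m with rfl | hm
    · rw [Finset.sum_eq_zero]
      · simp
      · intro k hk
        rw [Finset.mem_filter] at hk
        have := hs k hk.1
        omega
    · simpa [hm.ne'] using hren m hm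

lemma summable_mul_pow_of_tendsto_root {c : ℕ → ℕ} {μ y : ℝ}
    (hμ : Tendsto (fun n : ℕ => (c n : ℝ) ^ ((1 : ℝ) / (n : ℝ))) atTop (nhds μ))
    (hy : 0 < y) (h : μ < 1 / y) : Summable fun n => (c n : ℝ) * y ^ n := by
  have hμ0 : 0 ≤ μ := ge_of_tendsto' hμ fun n => by positivity
  obtain ⟨r, hr, hry⟩ := exists_between h
  have hr0 : 0 < r := hμ0.trans_lt hr
  have hry1 : r * y < 1 := by rwa [lt_div_iff₀ hy] at hry
  refine Summable.of_norm_bounded_eventually_nat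
    (summable_geometric_of_lt_one (by positivity) hry1) ?_
  filter_upwards [hμ.eventually (gt_mem_nhds hr), eventually_ge_atTop 1] with n hn hn1
  rw [Real.norm_of_nonneg (by positivity), mul_pow]
  gcongr
  calc (c n : ℝ) = ((c n : ℝ) ^ ((1 : ℝ) / (n : ℝ))) ^ n := by
        rw [one_div, Real.rpow_inv_natCast_pow (by positivity) (by omega)]
    _ ≤ r ^ n := by gcongr

lemma exists_lt_one_lt_sum (s : Finset ℕ) (a : ℕ → ℝ) {x : ℝ} (hx : 0 < x)
    (h : 1 < ∑ n ∈ s, a n * x ^ n) : ∃ y, 0 < y ∧ y < x ∧ 1 < ∑ n ∈ s, a n * y ^ n := by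
  have hc : Continuous fun y : ℝ => ∑ n ∈ s, a n * y ^ n := by fun_prop
  have h1 : ∀ᶠ y in nhdsWithin x (Set.Iio x), 1 < ∑ n ∈ s, a n * y ^ n :=
    (hc.continuousAt.eventually (lt_mem_nhds h)).filter_mono nhdsWithin_le_nhds
  obtain ⟨y, hy, hyx⟩ := (h1.and (Ioo_mem_nhdsLT hx)).exists
  exact ⟨y, hyx.1, hyx.2, hy⟩

/-- Let `x > 0` and let `(a'_n)_{n≥1}` be nonnegative integers with
`a'_n ≤ a_n` for every `n ≥ 1`. If some finite partial sum `Σ_{n=1}^{N} a'_n x^n` exceeds `1`,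
then `μ_taxi > 1/x`. -/
theorem muTaxi_lower_bound_from_irreducible_bridges (μ : ℝ)
    (hμ : Filter.Tendsto (fun n : ℕ => (taxiCount n : ℝ) ^ ((1 : ℝ) / (n : ℝ)))
      Filter.atTop (nhds μ))
    (x : ℝ) (hx : 0 < x) (a' : ℕ → ℕ) (ha' : ∀ n, 1 ≤ n → a' n ≤ irrBridgeCount n)
    (hsum : ∃ N : ℕ, 1 < ∑ n ∈ Finset.Icc 1 N, (a' n : ℝ) * x ^ n) :
    1 / x < μ := by
  obtain ⟨N, hN⟩ := hsum
  by_contra! hle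
  obtain ⟨y, hy, hyx, hy1⟩ := exists_lt_one_lt_sum _ (fun n => (a' n : ℝ)) hx hN
  have hsummable : Summable fun n => (taxiCount n : ℝ) * y ^ n :=
    summable_mul_pow_of_tendsto_root hμ hy (hle.trans_lt (one_div_lt_one_div_of_lt hy hyx))
  let w : ℕ → ℕ := fun n => (halfPlaneWalks n).ncard
  have hwc : ∀ n, w n ≤ taxiCount n := fun n =>
    Set.ncard_le_ncard (halfPlaneWalks_subset_originWalks n) (originWalks_finite n)
  have hw : Summable fun n => (w n : ℝ) * y ^ n :=
    Summable.of_nonneg_of_le (fun n => by positivity)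
      (fun n => by have := hwc n; gcongr) hsummable
  refine hy1.not_gt (sum_lt_one_of_renewal hw ?_ (fun n => by positivity) _
    (fun k hk => (Finset.mem_Icc.1 hk).1) fun m _ => ?_)
  · have : 0 < w 0 := ncard_halfPlaneWalks_zero_pos
    simpa using this
  · have hren : ∑ k ∈ Finset.Icc 1 N with k ≤ m, a' k * w (m - k) ≤ w m := by
      refine le_trans (Finset.sum_le_sum fun k hk => ?_) (sum_ncard_mul_ncard_le
        ((Finset.Icc 1 N).filter (· ≤ m)) m fun k hk => (Finset.mem_filter.1 hk).2)
      have hk1 : 1 ≤ k := (Finset.mem_Icc.1 (Finset.mem_filter.1 hk).1).1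
      exact Nat.mul_le_mul_right _ (irrBridgeCount_eq_ncard hk1 ▸ ha' k hk1)
    calc ∑ k ∈ Finset.Icc 1 N with k ≤ m, (a' k : ℝ) * y ^ k * ((w (m - k) : ℝ) * y ^ (m - k))
        = ((∑ k ∈ Finset.Icc 1 N with k ≤ m, a' k * w (m - k) : ℕ) : ℝ) * y ^ m := by
          rw [Nat.cast_sum, Finset.sum_mul]
          refine Finset.sum_congr rfl fun k hk => ?_
          rw [← pow_mul_pow_sub y (Finset.mem_filter.1 hk).2]
          push_cast
          ring
      _ ≤ (w m : ℝ) * y ^ m := by gcongr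
end
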